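/- arXiv:1410.4667 — 2 statements merged into one kernel-verified Lean document; each statement's English description precedes it below -/
import Mathlib

section
/- Let (G_i)_{i ∈ ι} be a family of groups and let G be their free product (the coproduct of the family). Let i ≠ j be indices with both G_i and G_j nontrivial, and let H_i, H_j be the images in G of the canonical embeddings of G_i and G_j respectively. Then there is no element g ∈ G with g·H_i·g⁻¹ = H_j. -/
open Monoid

/-- In a free product of groups, the images of two distinct nontrivial factors
under the canonical embeddings are not conjugate. -/
theorem stmt_2 {ι : Type*} (G : ι → Type*) [∀ i, Group (G i)]
    (i j : ι) (hij : i ≠ j) (hi : Nontrivial (G i)) (hj : Nontrivial (G j)) :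
    ¬ ∃ g : CoprodI G,
        Subgroup.map (MulAut.conj g).toMonoidHom (CoprodI.of : G i →* CoprodI G).range
          = (CoprodI.of : G j →* CoprodI G).range := by
  classical
  rintro ⟨g, hg⟩
  obtain ⟨x, hx⟩ := exists_ne (1 : G i)
  obtain ⟨y, hy⟩ : g * CoprodI.of x * g⁻¹ ∈ (CoprodI.of : G j →* CoprodI G).range :=
    hg ▸ Subgroup.mem_map_of_mem (MulAut.conj g).toMonoidHom ⟨x, rfl⟩
  -- The retraction of the free product onto `G i` kills the factor `G j`.
  have h := congrArg (CoprodI.lift (Pi.mulSingle i (MonoidHom.id (G i)))) hy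
  rw [map_mul, map_mul, map_inv, CoprodI.lift_of, CoprodI.lift_of, Pi.mulSingle_eq_same,
    Pi.mulSingle_eq_of_ne hij.symm, MonoidHom.one_apply, MonoidHom.id_apply] at h
  exact hx (conj_eq_one_iff.mp h.symm)
end

section
/- Let G₁ be a group, let g₁ ∈ G₁, let F be the free group on two generators a and b, and let G = G₁ ∗ F be the free product. Let φ : G → G be the unique group homomorphism which restricts to the identity on (the canonical image of) G₁ and sends a ↦ b·g₁ and b ↦ a·b. For every automorphism α of G₁ with α(g₁) = g₁, let α̂ : G → G be the unique homomorphism which restricts to α on G₁ and to the identity on F. Then α̂ commutes with φ, i.e. φ ∘ α̂ = α̂ ∘ φ as homomorphisms of G. -/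
open Monoid

/-- Let `G = G₁ ∗ F₂` with free generators `a = of 0`, `b = of 1`, and let `φ`
be the endomorphism of `G` restricting to the identity on `G₁` with `a ↦ b·g₁`,
`b ↦ a·b`. For every automorphism `α` of `G₁` fixing `g₁`, the extension `α̂`
of `α` to `G` which is the identity on `F₂` commutes with `φ`. -/
theorem stmt_7 {G₁ : Type*} [Group G₁] (g₁ : G₁)
    (φ : Coprod G₁ (FreeGroup (Fin 2)) →* Coprod G₁ (FreeGroup (Fin 2)))
    (hφ₁ : ∀ x : G₁, φ (Coprod.inl x) = Coprod.inl x)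
    (hφa : φ (Coprod.inr (FreeGroup.of 0)) =
      Coprod.inr (FreeGroup.of 1) * Coprod.inl g₁)
    (hφb : φ (Coprod.inr (FreeGroup.of 1)) =
      Coprod.inr (FreeGroup.of 0) * Coprod.inr (FreeGroup.of 1))
    (α : G₁ ≃* G₁) (hα : α g₁ = g₁)
    (αhat : Coprod G₁ (FreeGroup (Fin 2)) →* Coprod G₁ (FreeGroup (Fin 2)))
    (hα₁ : ∀ x : G₁, αhat (Coprod.inl x) = Coprod.inl (α x))
    (hα₂ : ∀ w : FreeGroup (Fin 2), αhat (Coprod.inr w) = Coprod.inr w) :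
    φ.comp αhat = αhat.comp φ := by
  refine Coprod.hom_ext ?_ (FreeGroup.ext_hom _ _ ?_)
  · ext x
    simp [hφ₁, hα₁]
  · intro i
    fin_cases i
    · simp [hφa, hα₁, hα₂, hα]
    · simp [hφb, hα₂]
end
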